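/- Let α ∈ ℓ^{1,∞}_{++} and identify α with Γ_α e_0 ∈ ℓ². For z ∈ ℂ∖[0,∞) set F(z) = ⟨(Γ_α² − zI)^{-1} e₀, e₀⟩ and G(z) = ⟨(Γ_α² − zI)^{-1} α, e₀⟩. Then F(z) ≠ 0 for every z ∈ ℂ∖[0,∞), and ⟨(Γ_{S*α}² − zI)^{-1} e₀, e₀⟩ = F(z) − G(z)² / (z·F(z)). -/

import Mathlib

open scoped ComplexInnerProductSpace ComplexOrder ENNReal NNReal
open MeasureTheory Filter

noncomputable section

abbrev ℓ2 : Type := lp (fun _ : ℕ => ℂ) 2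

def e (n : ℕ) : ℓ2 := lp.single 2 n 1

def IsHankelOp (α : ℕ → ℝ) (Γ : ℓ2 →L[ℂ] ℓ2) : Prop :=
  ∀ n m : ℕ, ⟪Γ (e n), e m⟫ = (α (n + m) : ℂ)

def PosOp (Γ : ℓ2 →L[ℂ] ℓ2) : Prop := ∀ x : ℓ2, 0 ≤ ⟪Γ x, x⟫

def MemL1infPP (α : ℕ → ℝ) (Γ ΓS : ℓ2 →L[ℂ] ℓ2) : Prop :=
  (∃ C : ℝ, ∀ n : ℕ, (n + 1 : ℝ) * |α n| ≤ C) ∧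
  IsHankelOp α Γ ∧ IsHankelOp (fun n => α (n + 1)) ΓS ∧ PosOp Γ ∧ PosOp ΓS
lemma inner_e_left (n : ℕ) (x : ℓ2) : ⟪e n, x⟫ = x n := by
  rw [e, lp.inner_single_left]
  simp

lemma PosOp.inner_map_left {Γ : ℓ2 →L[ℂ] ℓ2} (h : PosOp Γ) (x y : ℓ2) :
    ⟪Γ x, y⟫ = ⟪x, Γ y⟫ := by
  have hs : (Γ : ℓ2 →ₗ[ℂ] ℓ2).IsSymmetric := by
    rw [LinearMap.isSymmetric_iff_inner_map_self_real]
    intro v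
    exact Complex.conj_eq_iff_im.2 (Complex.nonneg_iff.1 (h v)).2.symm
  exact hs x y

lemma IsHankelOp.apply_e {α : ℕ → ℝ} {Γ : ℓ2 →L[ℂ] ℓ2} (h : IsHankelOp α Γ) (n m : ℕ) :
    Γ (e n) m = α (n + m) := by
  rw [← inner_e_left, ← inner_conj_symm, h, Complex.conj_ofReal]

lemma IsHankelOp.shift_apply {α : ℕ → ℝ} {Γ ΓS : ℓ2 →L[ℂ] ℓ2} (h : IsHankelOp α Γ)
    (hS : IsHankelOp (fun n => α (n + 1)) ΓS) (hp : PosOp Γ) (hpS : PosOp ΓS)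
    (x : ℓ2) (n : ℕ) : ΓS x n = Γ x (n + 1) := by
  have key : ΓS (e n) = Γ (e (n + 1)) := by
    ext m
    rw [h.apply_e, hS.apply_e]
    congr 2
    omega
  rw [← inner_e_left, ← inner_e_left, ← hp.inner_map_left, ← hpS.inner_map_left, key]

/-- The square of the shifted Hankel operator is a rank-one perturbation of `Γ ^ 2`. -/
lemma IsHankelOp.shift_sq_apply {α : ℕ → ℝ} {Γ ΓS : ℓ2 →L[ℂ] ℓ2} (h : IsHankelOp α Γ)
    (hS : IsHankelOp (fun n => α (n + 1)) ΓS) (hp : PosOp Γ) (hpS : PosOp ΓS) (y : ℓ2) :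
    ΓS (ΓS y) = Γ (Γ y) - ⟪Γ (e 0), y⟫ • Γ (e 0) := by
  refine ext_inner_left ℂ fun x => ?_
  have h1 := lp.hasSum_inner (𝕜 := ℂ) (ΓS x) (ΓS y)
  have h2 := (hasSum_nat_add_iff' 1).2 (lp.hasSum_inner (𝕜 := ℂ) (Γ x) (Γ y))
  simp only [h.shift_apply hS hp hpS] at h1
  have h3 := h1.unique h2
  rw [inner_sub_right, inner_smul_right, ← hp.inner_map_left x (Γ y),
    ← hpS.inner_map_left x (ΓS y), ← hp.inner_map_left x (e 0), hp.inner_map_left (e 0) y,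
    h3, inner_e_left, ← inner_conj_symm (Γ x) (e 0), inner_e_left]
  simp

theorem statement13 (α : ℕ → ℝ) (Γ ΓS : ℓ2 →L[ℂ] ℓ2) (hα : MemL1infPP α Γ ΓS)
    (hinv : ∀ z : ℂ, (∀ t : ℝ, 0 ≤ t → z ≠ (t : ℂ)) →
      IsUnit (Γ ^ 2 - z • (1 : ℓ2 →L[ℂ] ℓ2)))
    (hinvS : ∀ z : ℂ, (∀ t : ℝ, 0 ≤ t → z ≠ (t : ℂ)) →
      IsUnit (ΓS ^ 2 - z • (1 : ℓ2 →L[ℂ] ℓ2))) :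
    ∀ z : ℂ, (∀ t : ℝ, 0 ≤ t → z ≠ (t : ℂ)) →
      ⟪e 0, (Ring.inverse (Γ ^ 2 - z • 1) : ℓ2 →L[ℂ] ℓ2) (e 0)⟫ ≠ 0 ∧
      ⟪e 0, (Ring.inverse (ΓS ^ 2 - z • 1) : ℓ2 →L[ℂ] ℓ2) (e 0)⟫ =
        ⟪e 0, (Ring.inverse (Γ ^ 2 - z • 1) : ℓ2 →L[ℂ] ℓ2) (e 0)⟫ -
        (⟪e 0, (Ring.inverse (Γ ^ 2 - z • 1) : ℓ2 →L[ℂ] ℓ2) (Γ (e 0))⟫) ^ 2 /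
          (z * ⟪e 0, (Ring.inverse (Γ ^ 2 - z • 1) : ℓ2 →L[ℂ] ℓ2) (e 0)⟫) := by
  intro z hz
  obtain ⟨-, h, hS, hp, hpS⟩ := hα
  have hz0 : z ≠ 0 := by simpa using hz 0 le_rfl
  set R : ℓ2 →L[ℂ] ℓ2 := Ring.inverse (Γ ^ 2 - z • 1)
  set RS : ℓ2 →L[ℂ] ℓ2 := Ring.inverse (ΓS ^ 2 - z • 1)
  have hTR : (Γ ^ 2 - z • 1) * R = 1 := Ring.mul_inverse_cancel _ (hinv z hz)
  have hRT : R * (Γ ^ 2 - z • 1) = 1 := Ring.inverse_mul_cancel _ (hinv z hz)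
  have hRST : RS * (ΓS ^ 2 - z • 1) = 1 := Ring.inverse_mul_cancel _ (hinvS z hz)
  have hcomm : ∀ v, Γ (R v) = R (Γ v) := by
    have hT : Γ * (Γ ^ 2 - z • 1) = (Γ ^ 2 - z • 1) * Γ := by
      simp only [mul_sub, sub_mul, mul_smul_comm, smul_mul_assoc, mul_one, one_mul,
        ← pow_succ, ← pow_succ']
    have hRΓ : Γ * R = R * Γ := by
      calc Γ * R = R * (Γ ^ 2 - z • 1) * Γ * R := by rw [hRT, one_mul]
        _ = R * (Γ * ((Γ ^ 2 - z • 1) * R)) := by rw [mul_assoc R, ← hT, mul_assoc, mul_assoc]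
        _ = R * Γ := by rw [hTR, mul_one]
    exact fun v => DFunLike.congr_fun hRΓ v
  have hTRv : ∀ v, Γ (Γ (R v)) = v + z • R v := by
    intro v
    have := DFunLike.congr_fun hTR v
    simp only [pow_two, mul_apply_eq_comp, sub_apply,
      smul_apply, one_apply_eq_self] at this
    exact sub_eq_iff_eq_add.1 this
  have hres : ∀ v, RS v = R v + ⟪Γ (e 0), R v⟫ • RS (Γ (e 0)) := by
    intro v
    have := DFunLike.congr_fun hRST (R v)
    simp only [pow_two, mul_apply_eq_comp, sub_apply,
      smul_apply, one_apply_eq_self,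
      h.shift_sq_apply hS hp hpS, hTRv] at this
    rw [show v + z • R v - ⟪Γ (e 0), R v⟫ • Γ (e 0) - z • R v
      = v - ⟪Γ (e 0), R v⟫ • Γ (e 0) by abel, map_sub, map_smul] at this
    exact sub_eq_iff_eq_add.1 this
  have he : ⟪e 0, e 0⟫ = 1 := by
    rw [inner_e_left]
    simp [e]
  have hG : ⟪Γ (e 0), R (e 0)⟫ = ⟪e 0, R (Γ (e 0))⟫ := by rw [hp.inner_map_left, hcomm]
  have hF : ⟪Γ (e 0), R (Γ (e 0))⟫ = 1 + z * ⟪e 0, R (e 0)⟫ := by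
    rw [hp.inner_map_left, ← hcomm, hTRv, inner_add_right, inner_smul_right, he]
  have ha : R (Γ (e 0)) = -(z * ⟪e 0, R (e 0)⟫) • RS (Γ (e 0)) := by
    have := hres (Γ (e 0))
    rw [hF, add_smul, one_smul] at this
    rw [neg_smul, eq_neg_iff_add_eq_zero]
    rw [add_left_comm] at this
    exact left_eq_add.1 this
  have hF0 : ⟪e 0, R (e 0)⟫ ≠ 0 := by
    intro h0
    rw [h0, mul_zero, neg_zero, zero_smul] at ha
    rw [ha, h0] at hF
    simp at hF
  refine ⟨hF0, ?_⟩
  rw [hres (e 0), inner_add_right, inner_smul_right, hG]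
  have hg := congrArg (fun v => ⟪e 0, v⟫) ha
  simp only [inner_smul_right] at hg
  rw [hg]
  field_simp
  ring
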